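/- arXiv:2104.08705 — 3 statements merged into one kernel-verified Lean document; each statement's English description precedes it below -/
import Mathlib

section
/- Let T be a chain in P(ℕ) (a collection of subsets of ℕ totally ordered by inclusion). Then: (1) the closure under unions T_∪ := {⋃C : C ⊆ T}, the closure under intersections T_∩ := {⋂C : C ⊆ T}, and T_* := T_∪ ∪ T_∩ are each again chains (totally ordered by inclusion); and (2) T_* is closed under arbitrary unions and arbitrary intersections: for every C ⊆ T_*, both ⋃C ∈ T_* and ⋂C ∈ T_*. -/
/-- `T_∪`: closure of `T` under arbitrary unions. -/
def unionClosure (T : Set (Set ℕ)) : Set (Set ℕ) := {B | ∃ C ⊆ T, B = ⋃₀ C}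

/-- `T_∩`: closure of `T` under arbitrary intersections. -/
def interClosure (T : Set (Set ℕ)) : Set (Set ℕ) := {B | ∃ C ⊆ T, B = ⋂₀ C}

/-- `T_* = T_∪ ∪ T_∩`. -/
def starClosure (T : Set (Set ℕ)) : Set (Set ℕ) := unionClosure T ∪ interClosure T

/-- A set comparable with every member of `C` is comparable with `⋃₀ C`. -/
theorem sUnion_comparable {C : Set (Set ℕ)} {B : Set ℕ} (h : ∀ A ∈ C, A ⊆ B ∨ B ⊆ A) :
    ⋃₀ C ⊆ B ∨ B ⊆ ⋃₀ C := by
  by_cases hC : ∀ A ∈ C, A ⊆ B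
  · exact Or.inl (Set.sUnion_subset hC)
  · push Not at hC
    obtain ⟨A, hA, hAB⟩ := hC
    exact Or.inr (((h A hA).resolve_left hAB).trans (Set.subset_sUnion_of_mem hA))

/-- A set comparable with every member of `C` is comparable with `⋂₀ C`. -/
theorem sInter_comparable {C : Set (Set ℕ)} {B : Set ℕ} (h : ∀ A ∈ C, A ⊆ B ∨ B ⊆ A) :
    ⋂₀ C ⊆ B ∨ B ⊆ ⋂₀ C := by
  by_cases hC : ∀ A ∈ C, B ⊆ A
  · exact Or.inr (Set.subset_sInter hC)
  · push Not at hC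
    obtain ⟨A, hA, hBA⟩ := hC
    exact Or.inl ((Set.sInter_subset_of_mem hA).trans ((h A hA).resolve_right hBA))

/-- A set comparable with every member of `T` is comparable with every member of `T_*`. -/
theorem starClosure_comparable {T : Set (Set ℕ)} {B : Set ℕ} (h : ∀ A ∈ T, A ⊆ B ∨ B ⊆ A) :
    ∀ A ∈ starClosure T, A ⊆ B ∨ B ⊆ A := by
  rintro A (⟨C, hC, rfl⟩ | ⟨C, hC, rfl⟩)
  · exact sUnion_comparable fun A hA => h A (hC hA)
  · exact sInter_comparable fun A hA => h A (hC hA)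

theorem IsChain.starClosure_comparable_mem {T : Set (Set ℕ)} (hT : IsChain (· ⊆ ·) T) :
    ∀ A ∈ starClosure T, ∀ B ∈ T, A ⊆ B ∨ B ⊆ A :=
  fun A hA _ hB => starClosure_comparable (fun _ hD => hT.total hD hB) A hA

theorem IsChain.starClosure {T : Set (Set ℕ)} (hT : IsChain (· ⊆ ·) T) :
    IsChain (· ⊆ ·) (starClosure T) :=
  fun A hA B hB _ =>
    starClosure_comparable (fun D hD => (hT.starClosure_comparable_mem B hB D hD).symm) A hA

theorem IsChain.sUnion_mem_starClosure {T : Set (Set ℕ)} (hT : IsChain (· ⊆ ·) T)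
    {C : Set (Set ℕ)} (hC : C ⊆ _root_.starClosure T) : ⋃₀ C ∈ _root_.starClosure T := by
  by_cases hU : ⋃₀ C ⊆ ⋃₀ {t ∈ T | t ⊆ ⋃₀ C}
  · exact Or.inl ⟨_, Set.sep_subset _ _, hU.antisymm (Set.sUnion_subset fun t ht => ht.2)⟩
  obtain ⟨x, ⟨c, hc, hxc⟩, hx⟩ := Set.not_subset.mp hU
  have hcU : c ⊆ ⋃₀ C := Set.subset_sUnion_of_mem hc
  rcases hC hc with ⟨E, hE, rfl⟩ | ⟨E, hE, rfl⟩
  · obtain ⟨t, ht, hxt⟩ := hxc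
    exact absurd ⟨t, ⟨hE ht, (Set.subset_sUnion_of_mem ht).trans hcU⟩, hxt⟩ hx
  · have hUE : ⋃₀ C ⊆ ⋂₀ E := Set.subset_sInter fun t ht =>
      (sUnion_comparable fun A hA =>
        hT.starClosure_comparable_mem A (hC hA) t (hE ht)).resolve_right
          fun htU => hx ⟨t, ⟨hE ht, htU⟩, hxc t ht⟩
    exact Or.inr ⟨E, hE, hUE.antisymm hcU⟩

theorem IsChain.sInter_mem_starClosure {T : Set (Set ℕ)} (hT : IsChain (· ⊆ ·) T)
    {C : Set (Set ℕ)} (hC : C ⊆ _root_.starClosure T) : ⋂₀ C ∈ _root_.starClosure T := by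
  by_cases hI : ⋂₀ {t ∈ T | ⋂₀ C ⊆ t} ⊆ ⋂₀ C
  · exact Or.inr ⟨_, Set.sep_subset _ _, (Set.subset_sInter fun t ht => ht.2).antisymm hI⟩
  obtain ⟨x, hx, hxC⟩ := Set.not_subset.mp hI
  obtain ⟨c, hc, hxc⟩ : ∃ c ∈ C, x ∉ c := by simpa using hxC
  have hIc : ⋂₀ C ⊆ c := Set.sInter_subset_of_mem hc
  rcases hC hc with ⟨E, hE, rfl⟩ | ⟨E, hE, rfl⟩
  · have hEI : ⋃₀ E ⊆ ⋂₀ C := Set.sUnion_subset fun t ht =>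
      (sInter_comparable fun A hA =>
        hT.starClosure_comparable_mem A (hC hA) t (hE ht)).resolve_left
          fun hIt => hxc ⟨t, ht, hx t ⟨hE ht, hIt⟩⟩
    exact Or.inl ⟨E, hE, hIc.antisymm hEI⟩
  · exact absurd (fun t ht => hx t ⟨hE ht, hIc.trans (Set.sInter_subset_of_mem ht)⟩) hxc

theorem stmt0 (T : Set (Set ℕ)) (hT : IsChain (· ⊆ ·) T) :
    (IsChain (· ⊆ ·) (unionClosure T) ∧ IsChain (· ⊆ ·) (interClosure T) ∧
      IsChain (· ⊆ ·) (starClosure T)) ∧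
    (∀ C ⊆ starClosure T, ⋃₀ C ∈ starClosure T ∧ ⋂₀ C ∈ starClosure T) := by
  exact ⟨⟨hT.starClosure.mono Set.subset_union_left, hT.starClosure.mono Set.subset_union_right,
    hT.starClosure⟩, fun _ hC => ⟨hT.sUnion_mem_starClosure hC, hT.sInter_mem_starClosure hC⟩⟩
end

section
/- (1) For any nonempty collection C ⊆ P(ℕ), ν⁻(⋃C) ≥ sup{ν⁻(A) : A ∈ C}; in particular, if {A_k}_{k=1}^∞ ⊆ F are pairwise disjoint then ν⁻(⋃_{k=1}^∞ A_k) ≥ ∑_{k=1}^∞ ν(A_k). (2) If C is a nonempty chain in P(ℕ) such that ν_N(A) ≤ ν⁺(A) for all N ∈ ℕ and all A ∈ C, then ν⁺(⋃C) = sup{ν⁺(A) : A ∈ C}; if additionally C ⊆ F, then ⋃C ∈ F with ν(⋃C) = sup{ν(A) : A ∈ C}. In particular, if {A_k}_{k=1}^∞ ⊆ F are pairwise disjoint with ν_N(A_k) ≤ ν(A_k) for all k, N ∈ ℕ, then ⋃_{k=1}^∞ A_k ∈ F and ν(⋃_{k=1}^∞ A_k) = ∑_{k=1}^∞ ν(A_k).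 -/
/-- The partial average `ν_N(A) = (1/N)·∑_{n=1}^N 1_A(n)`. -/
noncomputable def nuN (A : Set ℕ) (N : ℕ) : ℝ :=
  (∑ n ∈ Finset.Icc 1 N, A.indicator (fun _ => (1 : ℝ)) n) / N

/-- The upper Cesàro limit `ν⁺(A)`. -/
noncomputable def nuPlus (A : Set ℕ) : ℝ :=
  Filter.limsup (fun N => nuN A N) Filter.atTop

/-- The lower Cesàro limit `ν⁻(A)`. -/
noncomputable def nuMinus (A : Set ℕ) : ℝ :=
  Filter.liminf (fun N => nuN A N) Filter.atTop

/-- `A ∈ F`: the Cesàro limit of `A` exists. -/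
def memF (A : Set ℕ) : Prop :=
  ∃ l : ℝ, Filter.Tendsto (fun N => nuN A N) Filter.atTop (nhds l)

/-- The Cesàro limit `ν(A)`; it coincides with `ν⁺(A)` whenever `A ∈ F`. -/
noncomputable def nu (A : Set ℕ) : ℝ := nuPlus A

/-- `A ∈ N`: `A` is a null set. -/
def nullSet (A : Set ℕ) : Prop := memF A ∧ nu A = 0

open Filter Set

theorem nuN_nonneg (A : Set ℕ) (N : ℕ) : 0 ≤ nuN A N :=
  div_nonneg (Finset.sum_nonneg fun n _ => indicator_nonneg (fun _ _ => zero_le_one) n)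
    N.cast_nonneg

theorem nuN_mono {A B : Set ℕ} (h : A ⊆ B) (N : ℕ) : nuN A N ≤ nuN B N := by
  unfold nuN
  gcongr

theorem nuN_le_one (A : Set ℕ) (N : ℕ) : nuN A N ≤ 1 :=
  (nuN_mono (subset_univ A) N).trans (by simpa [nuN] using div_self_le_one (N : ℝ))

theorem nuN_congr {A B : Set ℕ} {N : ℕ} (h : ∀ n ≤ N, n ∈ A ↔ n ∈ B) : nuN A N = nuN B N := by
  classical
  unfold nuN
  congr 1
  refine Finset.sum_congr rfl fun n hn => ?_
  simp only [indicator_apply, h n (Finset.mem_Icc.1 hn).2]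

theorem nuN_biUnion {ι : Type*} {A : ι → Set ℕ} (hA : Pairwise (Function.onFun Disjoint A))
    (s : Finset ι) (N : ℕ) : nuN (⋃ k ∈ s, A k) N = ∑ k ∈ s, nuN (A k) N := by
  simp only [nuN, ← Finset.sum_div]
  rw [Finset.sum_comm]
  congr 1
  refine Finset.sum_congr rfl fun n _ => ?_
  rw [Finset.indicator_biUnion s A fun i _ j _ hij => hA hij]

theorem isBoundedUnder_le_nuN (A : Set ℕ) :
    IsBoundedUnder (· ≤ ·) atTop (fun N => nuN A N) :=
  isBoundedUnder_of ⟨1, nuN_le_one A⟩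

theorem isBoundedUnder_ge_nuN (A : Set ℕ) :
    IsBoundedUnder (· ≥ ·) atTop (fun N => nuN A N) :=
  isBoundedUnder_of ⟨0, nuN_nonneg A⟩

theorem nuMinus_mono {A B : Set ℕ} (h : A ⊆ B) : nuMinus A ≤ nuMinus B :=
  liminf_le_liminf (Eventually.of_forall (nuN_mono h)) (isBoundedUnder_ge_nuN A)
    (isBoundedUnder_le_nuN B).isCoboundedUnder_ge

theorem nuPlus_mono {A B : Set ℕ} (h : A ⊆ B) : nuPlus A ≤ nuPlus B :=
  limsup_le_limsup (Eventually.of_forall (nuN_mono h))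
    (isBoundedUnder_ge_nuN A).isCoboundedUnder_le (isBoundedUnder_le_nuN B)

theorem nuPlus_le {A : Set ℕ} {a : ℝ} (h : ∀ N, nuN A N ≤ a) : nuPlus A ≤ a :=
  limsup_le_of_le (isBoundedUnder_ge_nuN A).isCoboundedUnder_le (Eventually.of_forall h)

theorem nuMinus_le_nuPlus (A : Set ℕ) : nuMinus A ≤ nuPlus A :=
  liminf_le_limsup (isBoundedUnder_le_nuN A) (isBoundedUnder_ge_nuN A)

theorem memF.tendsto_nu {A : Set ℕ} (h : memF A) :
    Tendsto (fun N => nuN A N) atTop (nhds (nu A)) := by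
  obtain ⟨l, hl⟩ := h
  rwa [nu, nuPlus, hl.limsup_eq]

theorem memF.nuMinus_eq {A : Set ℕ} (h : memF A) : nuMinus A = nu A :=
  h.tendsto_nu.liminf_eq

theorem memF_of_nuPlus_le_nuMinus {A : Set ℕ} (h : nuPlus A ≤ nuMinus A) : memF A :=
  ⟨nuPlus A, tendsto_of_le_liminf_of_limsup_le h le_rfl
    (isBoundedUnder_le_nuN A) (isBoundedUnder_ge_nuN A)⟩

theorem memF.nu_nonneg {A : Set ℕ} (h : memF A) : 0 ≤ nu A :=
  ge_of_tendsto' h.tendsto_nu (nuN_nonneg A)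

theorem tendsto_nuN_biUnion {ι : Type*} {A : ι → Set ℕ} (hF : ∀ k, memF (A k))
    (hA : Pairwise (Function.onFun Disjoint A)) (s : Finset ι) :
    Tendsto (fun N => nuN (⋃ k ∈ s, A k) N) atTop (nhds (∑ k ∈ s, nu (A k))) := by
  simp only [nuN_biUnion hA]
  exact tendsto_finsetSum s fun k _ => (hF k).tendsto_nu

theorem memF_biUnion {ι : Type*} {A : ι → Set ℕ} (hF : ∀ k, memF (A k))
    (hA : Pairwise (Function.onFun Disjoint A)) (s : Finset ι) : memF (⋃ k ∈ s, A k) :=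
  ⟨_, tendsto_nuN_biUnion hF hA s⟩

theorem nu_biUnion {ι : Type*} {A : ι → Set ℕ} (hF : ∀ k, memF (A k))
    (hA : Pairwise (Function.onFun Disjoint A)) (s : Finset ι) :
    nu (⋃ k ∈ s, A k) = ∑ k ∈ s, nu (A k) :=
  (tendsto_nuN_biUnion hF hA s).limsup_eq

theorem sSup_nuMinus_le {C : Set (Set ℕ)} (hC : C.Nonempty) :
    sSup (nuMinus '' C) ≤ nuMinus (⋃₀ C) :=
  csSup_le (hC.image _) (forall_mem_image.2 fun _ hA => nuMinus_mono (subset_sUnion_of_mem hA))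

theorem sum_nu_le_nuMinus_iUnion {ι : Type*} {A : ι → Set ℕ} (hF : ∀ k, memF (A k))
    (hA : Pairwise (Function.onFun Disjoint A)) (s : Finset ι) :
    ∑ k ∈ s, nu (A k) ≤ nuMinus (⋃ k, A k) := by
  rw [← nu_biUnion hF hA, ← (memF_biUnion hF hA s).nuMinus_eq]
  exact nuMinus_mono (iUnion₂_subset_iUnion _ _)

theorem summable_nu {ι : Type*} {A : ι → Set ℕ} (hF : ∀ k, memF (A k))
    (hA : Pairwise (Function.onFun Disjoint A)) : Summable fun k => nu (A k) :=
  summable_of_sum_le (fun k => (hF k).nu_nonneg) (sum_nu_le_nuMinus_iUnion hF hA)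

theorem tsum_nu_le_nuMinus_iUnion {ι : Type*} {A : ι → Set ℕ} (hF : ∀ k, memF (A k))
    (hA : Pairwise (Function.onFun Disjoint A)) : ∑' k, nu (A k) ≤ nuMinus (⋃ k, A k) :=
  (summable_nu hF hA).tsum_le_of_sum_le (sum_nu_le_nuMinus_iUnion hF hA)

theorem exists_mem_chain_nuN_sUnion_eq {C : Set (Set ℕ)} (hC : C.Nonempty)
    (hchain : IsChain (· ⊆ ·) C) (N : ℕ) : ∃ A ∈ C, nuN (⋃₀ C) N = nuN A N := by
  obtain ⟨A, hA, hsub⟩ := hchain.directedOn.exists_mem_subset_of_finite_of_subset_sUnion hC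
    ((finite_Iic N).inter_of_left (⋃₀ C)) inter_subset_right
  exact ⟨A, hA, nuN_congr fun n hn => ⟨fun h => hsub ⟨hn, h⟩, fun h => ⟨A, hA, h⟩⟩⟩

theorem nuPlus_sUnion_of_isChain {C : Set (Set ℕ)} (hC : C.Nonempty)
    (hchain : IsChain (· ⊆ ·) C) (h : ∀ A ∈ C, ∀ N : ℕ, nuN A N ≤ nuPlus A) :
    nuPlus (⋃₀ C) = sSup (nuPlus '' C) := by
  have hub : nuPlus (⋃₀ C) ∈ upperBounds (nuPlus '' C) :=
    forall_mem_image.2 fun _ hA => nuPlus_mono (subset_sUnion_of_mem hA)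
  refine le_antisymm (nuPlus_le fun N => ?_) (csSup_le (hC.image _) hub)
  obtain ⟨A, hA, hN⟩ := exists_mem_chain_nuN_sUnion_eq hC hchain N
  exact hN ▸ (h A hA N).trans (le_csSup ⟨_, hub⟩ (mem_image_of_mem _ hA))

theorem memF_sUnion_of_isChain {C : Set (Set ℕ)} (hC : C.Nonempty)
    (hchain : IsChain (· ⊆ ·) C) (h : ∀ A ∈ C, ∀ N : ℕ, nuN A N ≤ nuPlus A)
    (hF : ∀ A ∈ C, memF A) : memF (⋃₀ C) := by
  apply memF_of_nuPlus_le_nuMinus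
  rw [nuPlus_sUnion_of_isChain hC hchain h]
  change sSup (nu '' C) ≤ _
  rw [← image_congr fun A hA => (hF A hA).nuMinus_eq]
  exact sSup_nuMinus_le hC

theorem nuN_iUnion_le_tsum {A : ℕ → Set ℕ} (hF : ∀ k, memF (A k))
    (hA : Pairwise (Function.onFun Disjoint A)) (h : ∀ k N, nuN (A k) N ≤ nu (A k)) (N : ℕ) :
    nuN (⋃ k, A k) N ≤ ∑' k, nu (A k) := by
  have hmono : Monotone fun n => ⋃ k ∈ Finset.range n, A k := fun m n hmn =>
    biUnion_subset_biUnion_left (Finset.range_subset_range.2 hmn)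
  obtain ⟨_, ⟨n, rfl⟩, hn⟩ := exists_mem_chain_nuN_sUnion_eq
    (range_nonempty fun n => ⋃ k ∈ Finset.range n, A k) hmono.isChain_range N
  have hU : ⋃ k, A k = ⋃₀ range fun n => ⋃ k ∈ Finset.range n, A k := by
    ext x
    simp only [mem_iUnion, sUnion_range, Finset.mem_range]
    exact ⟨fun ⟨k, hk⟩ => ⟨k + 1, k, k.lt_succ_self, hk⟩, fun ⟨_, k, _, hk⟩ => ⟨k, hk⟩⟩
  rw [hU, hn, nuN_biUnion hA]
  exact (Finset.sum_le_sum fun k _ => h k N).trans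
    ((summable_nu hF hA).sum_le_tsum _ fun k _ => (hF k).nu_nonneg)

theorem stmt4 :
    (∀ C : Set (Set ℕ), C.Nonempty → sSup (nuMinus '' C) ≤ nuMinus (⋃₀ C)) ∧
    (∀ A : ℕ → Set ℕ, (∀ k, memF (A k)) → Pairwise (Function.onFun Disjoint A) →
      (∑' k, nu (A k)) ≤ nuMinus (⋃ k, A k)) ∧
    (∀ C : Set (Set ℕ), C.Nonempty → IsChain (· ⊆ ·) C →
      (∀ A ∈ C, ∀ N : ℕ, nuN A N ≤ nuPlus A) →
      nuPlus (⋃₀ C) = sSup (nuPlus '' C) ∧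
      ((∀ A ∈ C, memF A) → memF (⋃₀ C) ∧ nu (⋃₀ C) = sSup (nu '' C))) ∧
    (∀ A : ℕ → Set ℕ, (∀ k, memF (A k)) → Pairwise (Function.onFun Disjoint A) →
      (∀ k N, nuN (A k) N ≤ nu (A k)) →
      memF (⋃ k, A k) ∧ nu (⋃ k, A k) = ∑' k, nu (A k)) := by
  refine ⟨fun C hC => sSup_nuMinus_le hC, fun A hF hA => tsum_nu_le_nuMinus_iUnion hF hA,
    fun C hC hchain h => ?_, fun A hF hA h => ?_⟩
  · exact ⟨nuPlus_sUnion_of_isChain hC hchain h, fun hF =>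
      ⟨memF_sUnion_of_isChain hC hchain h hF, nuPlus_sUnion_of_isChain hC hchain h⟩⟩
  · have hle : nuPlus (⋃ k, A k) ≤ ∑' k, nu (A k) := nuPlus_le (nuN_iUnion_le_tsum hF hA h)
    have hge := tsum_nu_le_nuMinus_iUnion hF hA
    exact ⟨memF_of_nuPlus_le_nuMinus (hle.trans hge),
      le_antisymm hle (hge.trans (nuMinus_le_nuPlus _))⟩
end

section
/- Let A be a Boolean algebra, let M ⊆ A be a monotone class, and let A₀ be a (Boolean) subalgebra of A with A₀ ⊆ M. Suppose σ is the smallest monotone class in A containing A₀, i.e. σ is a monotone class with A₀ ⊆ σ ⊆ M, and σ is contained in every monotone class of A containing A₀. Then σ is the carrier of a countably complete subalgebra of A, and it is the smallest such: σ is closed under the Boolean operations, every countable subset of σ has a least upper bound in A that belongs to σ, and every countably complete subalgebra of A containing A₀ contains σ. -/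
/-- `M` is a monotone class in the Boolean algebra `α`: every monotone sequence in `M`
has a least upper bound (in `α`) belonging to `M`, and every antitone sequence in `M`
has a greatest lower bound (in `α`) belonging to `M`. -/
def MonotoneClassIn {α : Type*} [BooleanAlgebra α] (M : Set α) : Prop :=
  (∀ p : ℕ → α, Monotone p → (∀ k, p k ∈ M) → ∃ b ∈ M, IsLUB (Set.range p) b) ∧
  (∀ p : ℕ → α, Antitone p → (∀ k, p k ∈ M) → ∃ b ∈ M, IsGLB (Set.range p) b)

/-- `B` is (the carrier of) a Boolean subalgebra of `α`. -/
def IsBoolSubalgebra {α : Type*} [BooleanAlgebra α] (B : Set α) : Prop :=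
  ⊥ ∈ B ∧ ⊤ ∈ B ∧ (∀ p ∈ B, pᶜ ∈ B) ∧
  (∀ p ∈ B, ∀ q ∈ B, p ⊔ q ∈ B) ∧ (∀ p ∈ B, ∀ q ∈ B, p ⊓ q ∈ B)

/-- `B` is a countably complete subalgebra of `α`: it is a subalgebra and every
countable subset of `B` has a least upper bound in `α` that belongs to `B`. -/
def IsCountablyCompleteSubalgebra {α : Type*} [BooleanAlgebra α] (B : Set α) : Prop :=
  IsBoolSubalgebra B ∧ ∀ C : Set α, C ⊆ B → C.Countable → ∃ b ∈ B, IsLUB C b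

section Sequences

variable {α : Type*} [BooleanAlgebra α] {p : ℕ → α} {b : α}

theorem IsLUB.range_sup_const (h : IsLUB (Set.range p) b) (q : α) :
    IsLUB (Set.range fun k => p k ⊔ q) (b ⊔ q) := by
  refine ⟨?_, fun c hc => sup_le (h.2 ?_) (le_sup_right.trans (hc ⟨0, rfl⟩))⟩
  · rintro _ ⟨k, rfl⟩
    exact sup_le_sup_right (h.1 ⟨k, rfl⟩) q
  · rintro _ ⟨k, rfl⟩
    exact le_sup_left.trans (hc ⟨k, rfl⟩)

theorem IsGLB.range_sup_const (h : IsGLB (Set.range p) b) (q : α) :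
    IsGLB (Set.range fun k => p k ⊔ q) (b ⊔ q) := by
  refine ⟨?_, fun c hc => sdiff_le_iff'.1 (h.2 ?_)⟩
  · rintro _ ⟨k, rfl⟩
    exact sup_le_sup_right (h.1 ⟨k, rfl⟩) q
  · rintro _ ⟨k, rfl⟩
    exact sdiff_le_iff'.2 (hc ⟨k, rfl⟩)

theorem IsLUB.range_compl (h : IsLUB (Set.range p) b) :
    IsGLB (Set.range fun k => (p k)ᶜ) bᶜ := by
  refine ⟨?_, fun c hc => le_compl_comm.1 (h.2 ?_)⟩
  · rintro _ ⟨k, rfl⟩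
    exact compl_le_compl (h.1 ⟨k, rfl⟩)
  · rintro _ ⟨k, rfl⟩
    exact le_compl_comm.1 (hc ⟨k, rfl⟩)

theorem IsGLB.range_compl (h : IsGLB (Set.range p) b) :
    IsLUB (Set.range fun k => (p k)ᶜ) bᶜ := by
  refine ⟨?_, fun c hc => compl_le_iff_compl_le.1 (h.2 ?_)⟩
  · rintro _ ⟨k, rfl⟩
    exact compl_le_compl (h.1 ⟨k, rfl⟩)
  · rintro _ ⟨k, rfl⟩
    exact compl_le_iff_compl_le.1 (hc ⟨k, rfl⟩)

end Sequences

namespace MonotoneClassIn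

variable {α : Type*} [BooleanAlgebra α] {M : Set α}

theorem isLUB_mem (hM : MonotoneClassIn M) {p : ℕ → α} {b : α} (hp : Monotone p)
    (hpM : ∀ k, p k ∈ M) (hb : IsLUB (Set.range p) b) : b ∈ M := by
  obtain ⟨c, hcM, hc⟩ := hM.1 p hp hpM
  exact hb.unique hc ▸ hcM

theorem isGLB_mem (hM : MonotoneClassIn M) {p : ℕ → α} {b : α} (hp : Antitone p)
    (hpM : ∀ k, p k ∈ M) (hb : IsGLB (Set.range p) b) : b ∈ M := by
  obtain ⟨c, hcM, hc⟩ := hM.2 p hp hpM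
  exact hb.unique hc ▸ hcM

theorem sep_compl_mem (hM : MonotoneClassIn M) : MonotoneClassIn {p ∈ M | pᶜ ∈ M} := by
  refine ⟨fun p hp hpM => ?_, fun p hp hpM => ?_⟩
  · obtain ⟨b, hbM, hb⟩ := hM.1 p hp fun k => (hpM k).1
    exact ⟨b, ⟨hbM, hM.isGLB_mem (fun _ _ h => compl_le_compl (hp h)) (fun k => (hpM k).2)
      hb.range_compl⟩, hb⟩
  · obtain ⟨b, hbM, hb⟩ := hM.2 p hp fun k => (hpM k).1
    exact ⟨b, ⟨hbM, hM.isLUB_mem (fun _ _ h => compl_le_compl (hp h)) (fun k => (hpM k).2)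
      hb.range_compl⟩, hb⟩

theorem sep_sup_mem (hM : MonotoneClassIn M) (q : α) :
    MonotoneClassIn {p ∈ M | p ⊔ q ∈ M} := by
  refine ⟨fun p hp hpM => ?_, fun p hp hpM => ?_⟩
  · obtain ⟨b, hbM, hb⟩ := hM.1 p hp fun k => (hpM k).1
    exact ⟨b, ⟨hbM, hM.isLUB_mem (fun _ _ h => sup_le_sup_right (hp h) q)
      (fun k => (hpM k).2) (hb.range_sup_const q)⟩, hb⟩
  · obtain ⟨b, hbM, hb⟩ := hM.2 p hp fun k => (hpM k).1
    exact ⟨b, ⟨hbM, hM.isGLB_mem (fun _ _ h => sup_le_sup_right (hp h) q)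
      (fun k => (hpM k).2) (hb.range_sup_const q)⟩, hb⟩

theorem isCountablyCompleteSubalgebra (hM : MonotoneClassIn M) (hB : IsBoolSubalgebra M) :
    IsCountablyCompleteSubalgebra M := by
  refine ⟨hB, fun C hCM hC => ?_⟩
  rcases C.eq_empty_or_nonempty with rfl | hne
  · exact ⟨⊥, hB.1, isLUB_empty⟩
  obtain ⟨f, rfl⟩ := hC.exists_eq_range hne
  have hf : ∀ k, partialSups f k ∈ M := by
    intro k
    induction k with
    | zero => simpa using hCM ⟨0, rfl⟩
    | succ k ih =>
      rw [partialSups_add_one]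
      exact hB.2.2.2.1 _ ih _ (hCM ⟨k + 1, rfl⟩)
  obtain ⟨b, hbM, hb⟩ := hM.1 _ (partialSups f).monotone hf
  refine ⟨b, hbM, ?_⟩
  rwa [IsLUB, upperBounds_range_partialSups] at hb

end MonotoneClassIn

theorem IsCountablyCompleteSubalgebra.monotoneClassIn {α : Type*} [BooleanAlgebra α] {B : Set α}
    (hB : IsCountablyCompleteSubalgebra B) : MonotoneClassIn B := by
  have hlub : ∀ p : ℕ → α, (∀ k, p k ∈ B) → ∃ b ∈ B, IsLUB (Set.range p) b := fun p hp =>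
    hB.2 _ (Set.range_subset_iff.2 hp) (Set.countable_range p)
  refine ⟨fun p _ => hlub p, fun p _ hp => ?_⟩
  obtain ⟨b, hbB, hb⟩ := hlub (fun k => (p k)ᶜ) fun k => hB.1.2.2.1 _ (hp k)
  exact ⟨bᶜ, hB.1.2.2.1 _ hbB, by simpa using hb.range_compl⟩

theorem stmt9 {α : Type*} [BooleanAlgebra α] (M : Set α) (hM : MonotoneClassIn M)
    (A₀ : Set α) (hA₀ : IsBoolSubalgebra A₀) (hA₀M : A₀ ⊆ M)
    (σ : Set α) (hσ : MonotoneClassIn σ) (hA₀σ : A₀ ⊆ σ) (hσM : σ ⊆ M)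
    (hmin : ∀ M' : Set α, MonotoneClassIn M' → A₀ ⊆ M' → σ ⊆ M') :
    IsCountablyCompleteSubalgebra σ ∧
    ∀ B : Set α, IsCountablyCompleteSubalgebra B → A₀ ⊆ B → σ ⊆ B := by
  refine ⟨hσ.isCountablyCompleteSubalgebra ?_,
    fun B hB hA₀B => hmin B hB.monotoneClassIn hA₀B⟩
  obtain ⟨hbot, htop, hcompl, hsup, -⟩ := hA₀
  have hσcompl : ∀ p ∈ σ, pᶜ ∈ σ := fun p hp =>
    (hmin _ hσ.sep_compl_mem (fun q hq => ⟨hA₀σ hq, hA₀σ (hcompl q hq)⟩) hp).2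
  have hσsup_of_mem : ∀ q ∈ A₀, ∀ p ∈ σ, p ⊔ q ∈ σ := fun q hq p hp =>
    (hmin _ (hσ.sep_sup_mem q) (fun r hr => ⟨hA₀σ hr, hA₀σ (hsup r hr q hq)⟩) hp).2
  have hσsup : ∀ p ∈ σ, ∀ q ∈ σ, p ⊔ q ∈ σ := fun p hp q hq =>
    (hmin _ (hσ.sep_sup_mem q)
      (fun r hr => ⟨hA₀σ hr, sup_comm q r ▸ hσsup_of_mem r hr q hq⟩) hp).2
  refine ⟨hA₀σ hbot, hA₀σ htop, hσcompl, hσsup, fun p hp q hq => ?_⟩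
  simpa using hσcompl _ (hσsup _ (hσcompl p hp) _ (hσcompl q hq))
end
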